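/- Assume there are functions κ^d_min, κ^d_max on (y_L,y_R) with 0 ≤ κ^d_min(y) ≤ d(x,y) ≤ κ^d_max(y) < ∞ for every (x,y), and functions κ^e_min, κ^e_max on (x_L,x_R) with 0 ≤ κ^e_min(x) ≤ e(x,y) ≤ κ^e_max(x) < ∞ for every (x,y). Assume that for each y the function x ↦ d(x,y) is convex or concave on (x_L,x_R), and set κ^d(y) = κ^d_min(y) in the convex case and κ^d(y) = κ^d_max(y) in the concave case; similarly for each x the function y ↦ e(x,y) is convex or concave on (y_L,y_R), with κ^e(x) defined analogously. If κ^d(y) − √2·(κ^d_max(y) − κ^d_min(y))/ς_α ≥ 0 for every y and κ^e(x) − √2·(κ^e_max(x) − κ^e_min(x))/ς_β ≥ 0 for every x, then the symmetric part of A, namely (A + Aᵀ)/2, is negative semidefinite. -/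

import Mathlib

open Matrix Kronecker

/-- The Grünwald–Letnikov coefficients `g_k^{(γ)}`. -/
noncomputable def gcoef (γ : ℝ) : ℕ → ℝ
  | 0 => 1
  | (k+1) => (1 - (γ + 1) / (k + 1 : ℕ)) * gcoef γ k

/-- The WSGD coefficients `w_k^{(γ)}`. -/
noncomputable def wcoef (γ : ℝ) : ℕ → ℝ
  | 0 => γ / 2 * gcoef γ 0
  | (k+1) => γ / 2 * gcoef γ (k+1) + (2 - γ) / 2 * gcoef γ k

/-- The `m × m` lower-Hessenberg Toeplitz matrix `G_γ`. -/
noncomputable def Gmat (γ : ℝ) (m : ℕ) : Matrix (Fin m) (Fin m) ℝ :=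
  Matrix.of fun i j => if (j : ℕ) ≤ (i : ℕ) + 1 then wcoef γ ((i : ℕ) + 1 - (j : ℕ)) else 0

lemma choose_succ_mul (a : ℂ) (k : ℕ) :
    Ring.choose a (k + 1) * (k + 1 : ℂ) = Ring.choose a k * (a - k) := by
  have hk : ((k.factorial : ℕ) : ℂ) ≠ 0 := by exact_mod_cast k.factorial_ne_zero
  have hk1 : (k + 1 : ℂ) ≠ 0 := by exact_mod_cast k.succ_ne_zero
  rw [Ring.choose_eq_smul, Ring.choose_eq_smul, descPochhammer_succ_right]
  simp only [Polynomial.smeval_mul, Polynomial.smeval_sub, Polynomial.smeval_X,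
    Polynomial.smeval_natCast, Nat.factorial_succ, smul_eq_mul]
  push_cast
  field_simp
  simp

lemma gcoef_eq_choose (γ : ℝ) (k : ℕ) :
    (gcoef γ k : ℂ) = (-1) ^ k * Ring.choose (γ : ℂ) k := by
  induction k with
  | zero => simp [gcoef]
  | succ k ih =>
    have h := choose_succ_mul (γ : ℂ) k
    have hk1 : (k + 1 : ℂ) ≠ 0 := by exact_mod_cast k.succ_ne_zero
    have h' : Ring.choose (γ : ℂ) (k + 1) = Ring.choose (γ : ℂ) k * (γ - k) / (k + 1) := by
      rw [← h]; field_simp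
    rw [gcoef, h']
    push_cast
    rw [ih, pow_succ]
    field_simp
    ring

lemma hasSum_gcoef_of_norm_lt_one (γ : ℝ) {z : ℂ} (hz : ‖z‖ < 1) :
    HasSum (fun k => (gcoef γ k : ℂ) * z ^ k) ((1 - z) ^ (γ : ℂ)) := by
  have h := (Complex.one_add_cpow_hasFPowerSeriesOnBall_zero (a := (γ : ℂ))).hasSum
    (y := -z) (by simpa [Metric.mem_eball, edist_zero_right, enorm_eq_nnnorm, ← NNReal.coe_lt_one]
      using hz)
  simpa [binomialSeries, gcoef_eq_choose, neg_pow z, ← sub_eq_add_neg, mul_comm, mul_left_comm,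
    mul_assoc] using h

/-- Partial sums of the Grünwald–Letnikov coefficients. -/
lemma sum_gcoef_succ (γ : ℝ) (n : ℕ) :
    ∑ k ∈ Finset.range (n + 1), gcoef γ k = gcoef (γ - 1) n := by
  induction n with
  | zero => simp [gcoef]
  | succ n ih =>
    rw [Finset.sum_range_succ, ih]
    have key : ∀ n : ℕ, gcoef γ (n + 1) * γ = -(γ / (n + 1)) * gcoef (γ - 1) n * γ := by
      intro n
      induction n with
      | zero => simp [gcoef]
      | succ n ih =>
        rw [gcoef, mul_assoc, ih, gcoef]
        push_cast
        field_simp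
        ring
    rcases eq_or_ne γ 0 with rfl | h
    · have h0 : ∀ n : ℕ, gcoef 0 (n + 1) = 0 := by
        intro n
        induction n with
        | zero => simp [gcoef]
        | succ n ih => rw [gcoef, ih, mul_zero]
      rw [h0, gcoef]
      simp
    · rw [mul_right_cancel₀ h (key n)]
      conv_rhs => rw [gcoef]
      push_cast
      ring

lemma gcoef_nonneg {γ : ℝ} (hγ : γ ∈ Set.Ioo (1 : ℝ) 2) (k : ℕ) : 0 ≤ gcoef γ (k + 2) := by
  obtain ⟨h1, h2⟩ := hγ
  induction k with
  | zero => norm_num [gcoef]; nlinarith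
  | succ k ih =>
    rw [gcoef]
    refine mul_nonneg ?_ ih
    rw [sub_nonneg, div_le_one (by positivity)]
    push_cast
    linarith [(Nat.cast_nonneg k : (0 : ℝ) ≤ k)]

lemma gcoef_sub_one_nonpos {γ : ℝ} (hγ : γ ∈ Set.Ioo (1 : ℝ) 2) (k : ℕ) :
    gcoef (γ - 1) (k + 1) ≤ 0 := by
  obtain ⟨h1, h2⟩ := hγ
  induction k with
  | zero => norm_num [gcoef]; linarith
  | succ k ih =>
    rw [gcoef]
    refine mul_nonpos_of_nonneg_of_nonpos ?_ ih
    rw [sub_nonneg, div_le_one (by positivity)]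
    push_cast
    linarith [(Nat.cast_nonneg k : (0 : ℝ) ≤ k)]

lemma summable_gcoef {γ : ℝ} (hγ : γ ∈ Set.Ioo (1 : ℝ) 2) : Summable (gcoef γ) := by
  rw [← summable_nat_add_iff 2]
  refine summable_of_sum_range_le (c := γ - 1) (gcoef_nonneg hγ) fun n => ?_
  have h := sum_gcoef_succ γ (n + 1)
  rw [Finset.sum_range_succ', Finset.sum_range_succ'] at h
  have h' := gcoef_sub_one_nonpos hγ n
  rw [← h] at h'
  norm_num [gcoef] at h'
  norm_num [gcoef]
  linarith

lemma wcoef_nonneg {γ : ℝ} (hγ : γ ∈ Set.Ioo (1 : ℝ) 2) (k : ℕ) : 0 ≤ wcoef γ (k + 3) := by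
  have h1 := gcoef_nonneg hγ k
  have h2 := gcoef_nonneg hγ (k + 1)
  obtain ⟨h3, h4⟩ := hγ
  rw [wcoef]
  have : 0 ≤ γ / 2 * gcoef γ (k + 2 + 1) := mul_nonneg (by linarith) h2
  have : 0 ≤ (2 - γ) / 2 * gcoef γ (k + 2) := mul_nonneg (by linarith) h1
  linarith

lemma wcoef_zero_add_two_nonneg {γ : ℝ} (hγ : γ ∈ Set.Ioo (1 : ℝ) 2) :
    0 ≤ wcoef γ 0 + wcoef γ 2 := by
  obtain ⟨h1, h2⟩ := hγ
  norm_num [wcoef, gcoef]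
  nlinarith [mul_pos (sub_pos.2 h1) (sub_pos.2 h2),
    mul_pos (mul_pos (sub_pos.2 h1) (sub_pos.2 h2)) (sub_pos.2 h1),
    mul_pos (mul_pos (sub_pos.2 h1) (sub_pos.2 h1)) (sub_pos.2 h1)]

lemma sum_wcoef_succ (γ : ℝ) (n : ℕ) :
    ∑ k ∈ Finset.range (n + 2), wcoef γ k
      = γ / 2 * gcoef (γ - 1) (n + 1) + (2 - γ) / 2 * gcoef (γ - 1) n := by
  rw [Finset.sum_range_succ', ← sum_gcoef_succ, ← sum_gcoef_succ, Finset.sum_range_succ' _ (n + 1)]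
  simp only [wcoef, Finset.sum_add_distrib, Finset.mul_sum, mul_add]
  ring

lemma sum_wcoef_nonpos {γ : ℝ} (hγ : γ ∈ Set.Ioo (1 : ℝ) 2) (n : ℕ) :
    ∑ k ∈ Finset.range (n + 3), wcoef γ k ≤ 0 := by
  rw [sum_wcoef_succ γ (n + 1)]
  have h1 := gcoef_sub_one_nonpos hγ n
  have h2 := gcoef_sub_one_nonpos hγ (n + 1)
  obtain ⟨h3, h4⟩ := hγ
  nlinarith

lemma summable_wcoef {γ : ℝ} (hγ : γ ∈ Set.Ioo (1 : ℝ) 2) : Summable (wcoef γ) := by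
  rw [← summable_nat_add_iff 1]
  exact (((summable_nat_add_iff 1).2 (summable_gcoef hγ)).mul_left _).add
    ((summable_gcoef hγ).mul_left _)

lemma hasSum_gcoef_of_norm_eq_one {γ : ℝ} (hγ : γ ∈ Set.Ioo (1 : ℝ) 2) {z : ℂ} (hz : ‖z‖ = 1)
    (hre : z.re < 1) :
    HasSum (fun k => (gcoef γ k : ℂ) * z ^ k) ((1 - z) ^ (γ : ℂ)) := by
  have hs : Summable fun k => (gcoef γ k : ℂ) * z ^ k :=
    Summable.of_norm (by simpa [hz] using (summable_gcoef hγ).abs)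
  have habel := Complex.tendsto_tsum_powerSeries_nhdsWithin_lt hs.hasSum.tendsto_sum_nat
  rw [Filter.tendsto_map'_iff] at habel
  have hlim : Filter.Tendsto (fun r : ℝ => (1 - (r : ℂ) * z) ^ (γ : ℂ)) (nhdsWithin 1 (Set.Iio 1))
      (nhds ((1 - ((1 : ℝ) : ℂ) * z) ^ (γ : ℂ))) := by
    refine Filter.Tendsto.mono_left (ContinuousAt.tendsto ?_) nhdsWithin_le_nhds
    refine ContinuousAt.cpow (by fun_prop) continuousAt_const (Or.inl ?_)
    simpa using hre
  have heq : (fun r : ℝ => (1 - (r : ℂ) * z) ^ (γ : ℂ)) =ᶠ[nhdsWithin 1 (Set.Iio 1)]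
      ((fun x : ℂ => ∑' n, (gcoef γ n : ℂ) * z ^ n * x ^ n) ∘ Complex.ofReal) := by
    filter_upwards [Ioo_mem_nhdsLT (zero_lt_one' ℝ)] with r hr
    have hr' : ‖(r : ℂ) * z‖ < 1 := by
      simpa [hz, abs_of_pos hr.1] using hr.2
    rw [← (hasSum_gcoef_of_norm_lt_one γ hr').tsum_eq]
    simp [mul_pow, mul_assoc, mul_comm]
  have := tendsto_nhds_unique (hlim.congr' heq) habel
  simp only [Complex.ofReal_one, one_mul] at this
  rw [this]
  exact hs.hasSum

lemma hasSum_wcoef {γ : ℝ} (hγ : γ ∈ Set.Ioo (1 : ℝ) 2) {z : ℂ} (hz : ‖z‖ = 1)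
    (hre : z.re < 1) :
    HasSum (fun k => (wcoef γ k : ℂ) * z ^ k)
      ((γ / 2 + (2 - γ) / 2 * z) * (1 - z) ^ (γ : ℂ)) := by
  have h := hasSum_gcoef_of_norm_eq_one hγ hz hre
  rw [← hasSum_nat_add_iff' 1]
  have h1 := ((hasSum_nat_add_iff' 1).2 h).mul_left (γ / 2 : ℂ)
  have h2 := h.mul_left ((2 - γ) / 2 * z : ℂ)
  convert! h1.add h2 using 1
  · ext k
    simp only [wcoef]
    push_cast
    ring
  · simp [wcoef, gcoef]
    ring

/-- The generating function of the Toeplitz matrices `Gmat γ m`. -/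
noncomputable def wsgdSymbol (γ θ : ℝ) : ℂ :=
  ∑' k : ℕ, (wcoef γ k : ℂ) * Complex.exp (((k : ℂ) - 1) * θ * Complex.I)

lemma cos_mul_sin_le_mul_sin_mul_cos {δ : ℝ} (hδ : δ ∈ Set.Ioo (0 : ℝ) 1) {t : ℝ}
    (ht : t ∈ Set.Icc 0 Real.pi) :
    0 ≤ δ * Real.sin t * Real.cos (δ * t) - Real.cos t * Real.sin (δ * t) := by
  obtain ⟨h1, h2⟩ := hδ
  have hd : ∀ x : ℝ, HasDerivAt
      (fun t => δ * Real.sin t * Real.cos (δ * t) - Real.cos t * Real.sin (δ * t))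
      ((1 - δ ^ 2) * (Real.sin x * Real.sin (δ * x))) x := by
    intro x
    have hl : HasDerivAt (fun t : ℝ => δ * t) δ x := by simpa using (hasDerivAt_id x).const_mul δ
    have := (((Real.hasDerivAt_sin x).const_mul δ).mul hl.cos).sub
      ((Real.hasDerivAt_cos x).mul hl.sin)
    convert! this using 1
    ring
  have hmono : MonotoneOn
      (fun t => δ * Real.sin t * Real.cos (δ * t) - Real.cos t * Real.sin (δ * t))
      (Set.Icc 0 Real.pi) := by
    refine monotoneOn_of_deriv_nonneg (convex_Icc _ _)
      (fun x _ => (hd x).continuousAt.continuousWithinAt)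
      (fun x _ => (hd x).differentiableAt.differentiableWithinAt) fun x hx => ?_
    rw [interior_Icc] at hx
    rw [(hd x).deriv]
    refine mul_nonneg (by nlinarith) (mul_nonneg
      (Real.sin_nonneg_of_nonneg_of_le_pi hx.1.le hx.2.le)
      (Real.sin_nonneg_of_nonneg_of_le_pi (mul_nonneg h1.le hx.1.le) ?_))
    nlinarith [hx.1, hx.2]
  simpa using hmono (Set.left_mem_Icc.2 Real.pi_pos.le) ht ht.1

lemma wsgdSymbol_factor_sector {γ : ℝ} (hγ : γ ∈ Set.Ioo (1 : ℝ) 2) {t : ℝ}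
    (ht : t ∈ Set.Ioo 0 Real.pi) :
    |Real.cos (γ * Real.pi / 2)| *
        ‖((Real.cos t : ℂ) - (γ - 1) * Real.sin t * Complex.I) *
          Complex.exp (((γ - 1) * t - γ * Real.pi / 2 : ℝ) * Complex.I)‖ ≤
      -(((Real.cos t : ℂ) - (γ - 1) * Real.sin t * Complex.I) *
          Complex.exp (((γ - 1) * t - γ * Real.pi / 2 : ℝ) * Complex.I)).re := by
  obtain ⟨δ, rfl⟩ : ∃ δ, γ = δ + 1 := ⟨γ - 1, by ring⟩
  have hδ : δ ∈ Set.Ioo (0 : ℝ) 1 := ⟨by linarith [hγ.1], by linarith [hγ.2]⟩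
  set Φ := δ * Real.pi / 2 with hΦ
  set s := δ * t - Φ with hs
  have hΦ0 : 0 < Φ := by have := mul_pos hδ.1 Real.pi_pos; linarith
  have hΦ1 : Φ < Real.pi / 2 := by have := mul_lt_mul_of_pos_right hδ.2 Real.pi_pos; linarith
  have hsin : 0 < Real.sin Φ := Real.sin_pos_of_pos_of_lt_pi hΦ0 (by linarith [Real.pi_pos])
  have hcos : 0 < Real.cos Φ := Real.cos_pos_of_mem_Ioo ⟨by linarith, hΦ1⟩
  have hς : |Real.cos ((δ + 1) * Real.pi / 2)| = Real.sin Φ := by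
    rw [show (δ + 1) * Real.pi / 2 = Φ + Real.pi / 2 by rw [hΦ]; ring, Real.cos_add_pi_div_two,
      abs_neg, abs_of_pos hsin]
  have hφ : (δ + 1 - 1) * t - (δ + 1) * Real.pi / 2 = s - Real.pi / 2 := by
    rw [hs, hΦ]; ring
  have e1 : δ * t = s + Φ := by rw [hs]; ring
  have e2 : δ * (Real.pi - t) = Φ - s := by rw [hs, hΦ]; ring
  have k1 := cos_mul_sin_le_mul_sin_mul_cos hδ (t := t) ⟨ht.1.le, ht.2.le⟩
  have k2 := cos_mul_sin_le_mul_sin_mul_cos hδ (t := Real.pi - t)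
    ⟨by linarith [ht.2], by linarith [ht.1]⟩
  rw [e1, Real.cos_add, Real.sin_add] at k1
  rw [e2, Real.sin_pi_sub, Real.cos_pi_sub, Real.cos_sub Φ s, Real.sin_sub Φ s] at k2
  rw [hς, hφ]
  set X := ((Real.cos t : ℂ) - (((δ + 1 : ℝ) : ℂ) - 1) * Real.sin t * Complex.I) *
          Complex.exp ((s - Real.pi / 2 : ℝ) * Complex.I) with hX
  have hre : X.re = Real.cos t * Real.sin s - δ * Real.sin t * Real.cos s := by
    rw [hX, Complex.exp_mul_I, ← Complex.ofReal_cos, ← Complex.ofReal_sin,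
      Real.cos_sub_pi_div_two, Real.sin_sub_pi_div_two]
    simp [-Complex.ofReal_cos, -Complex.ofReal_sin]
  have him : X.im = -(Real.cos t * Real.cos s) - δ * Real.sin t * Real.sin s := by
    rw [hX, Complex.exp_mul_I, ← Complex.ofReal_cos, ← Complex.ofReal_sin,
      Real.cos_sub_pi_div_two, Real.sin_sub_pi_div_two]
    simp [-Complex.ofReal_cos, -Complex.ofReal_sin]
    ring
  have j1 : 0 ≤ -X.re * Real.cos Φ + X.im * Real.sin Φ := by rw [hre, him]; linarith
  have j2 : 0 ≤ -X.re * Real.cos Φ - X.im * Real.sin Φ := by rw [hre, him]; linarith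
  have hp : 0 ≤ -X.re := by
    by_contra hlt
    nlinarith [mul_pos (neg_pos.2 (not_le.1 hlt)) hcos]
  have hsq : (X.im * Real.sin Φ) ^ 2 ≤ (-X.re * Real.cos Φ) ^ 2 := by
    nlinarith [mul_nonneg j1 j2]
  refine abs_le_of_sq_le_sq' ?_ hp |>.2
  rw [mul_pow, Complex.sq_norm, Complex.normSq_apply]
  nlinarith [Real.sin_sq_add_cos_sq Φ]

lemma one_sub_exp_cpow (γ : ℝ) {t : ℝ} (ht : t ∈ Set.Ioo 0 Real.pi) :
    (1 - Complex.exp ((2 * t : ℝ) * Complex.I)) ^ (γ : ℂ) =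
      ((2 * Real.sin t) ^ γ : ℝ) * Complex.exp ((γ * (t - Real.pi / 2) : ℝ) * Complex.I) := by
  have hsin : 0 < Real.sin t := Real.sin_pos_of_pos_of_lt_pi ht.1 ht.2
  have h1 : 1 - Complex.exp ((2 * t : ℝ) * Complex.I) =
      ((2 * Real.sin t : ℝ) : ℂ) * Complex.exp ((t - Real.pi / 2 : ℝ) * Complex.I) := by
    rw [Complex.exp_mul_I, Complex.exp_mul_I, ← Complex.ofReal_cos, ← Complex.ofReal_sin,
      ← Complex.ofReal_cos, ← Complex.ofReal_sin,
      Real.cos_sub_pi_div_two, Real.sin_sub_pi_div_two, Real.cos_two_mul, Real.sin_two_mul]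
    apply Complex.ext
    · simp [-Complex.ofReal_cos, -Complex.ofReal_sin, pow_two]
      nlinarith [Real.sin_sq_add_cos_sq t]
    · simp [-Complex.ofReal_cos, -Complex.ofReal_sin, pow_two]
  have h2 : 0 < 2 * Real.sin t := by linarith
  have hlog : Complex.log (Complex.exp ((t - Real.pi / 2 : ℝ) * Complex.I)) =
      (t - Real.pi / 2 : ℝ) * Complex.I :=
    Complex.log_exp (by simp; linarith [ht.1, Real.pi_pos]) (by simp; linarith [ht.2, Real.pi_pos])
  rw [h1, Complex.cpow_def_of_ne_zero
      (mul_ne_zero (by exact_mod_cast h2.ne') (Complex.exp_ne_zero _)),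
    Complex.log_ofReal_mul h2 (Complex.exp_ne_zero _), hlog, Real.rpow_def_of_pos h2,
    Complex.ofReal_exp, ← Complex.exp_add]
  congr 1
  push_cast
  ring

lemma wsgdSymbol_sector {γ : ℝ} (hγ : γ ∈ Set.Ioo (1 : ℝ) 2) {θ : ℝ}
    (hθ : θ ∈ Set.Ioo 0 (2 * Real.pi)) :
    |Real.cos (γ * Real.pi / 2)| * ‖wsgdSymbol γ θ‖ ≤ -(wsgdSymbol γ θ).re := by
  obtain ⟨t, rfl⟩ : ∃ t, θ = 2 * t := ⟨θ / 2, by ring⟩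
  have ht : t ∈ Set.Ioo 0 Real.pi := ⟨by linarith [hθ.1], by linarith [hθ.2]⟩
  have hsin : 0 < Real.sin t := Real.sin_pos_of_pos_of_lt_pi ht.1 ht.2
  set z := Complex.exp ((2 * t : ℝ) * Complex.I) with hz
  have hz1 : ‖z‖ = 1 := Complex.norm_exp_ofReal_mul_I _
  have hre : z.re < 1 := by
    rw [hz, Complex.exp_ofReal_mul_I_re, Real.cos_two_mul]
    nlinarith [Real.sin_sq_add_cos_sq t]
  have hsymb : wsgdSymbol γ (2 * t) = ((2 * Real.sin t) ^ γ : ℝ) *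
      (((Real.cos t : ℂ) - (γ - 1) * Real.sin t * Complex.I) *
          Complex.exp (((γ - 1) * t - γ * Real.pi / 2 : ℝ) * Complex.I)) := by
    have h := (hasSum_wcoef hγ hz1 hre).mul_left (Complex.exp (-((2 * t : ℝ) * Complex.I)))
    have h' : wsgdSymbol γ (2 * t) = Complex.exp (-((2 * t : ℝ) * Complex.I)) *
        ((γ / 2 + (2 - γ) / 2 * z) * (1 - z) ^ (γ : ℂ)) := by
      rw [← h.tsum_eq, wsgdSymbol]
      congr 1
      ext k
      rw [hz, ← Complex.exp_nat_mul, mul_left_comm, ← Complex.exp_add]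
      congr 2
      push_cast
      ring
    rw [h', one_sub_exp_cpow γ ht]
    have hA : Complex.exp (-((2 * t : ℝ) * Complex.I)) * (γ / 2 + (2 - γ) / 2 * z) =
        Complex.exp (-((t : ℝ) * Complex.I)) *
          ((Real.cos t : ℂ) - (γ - 1) * Real.sin t * Complex.I) := by
      have e : Complex.exp (-((2 * t : ℝ) * Complex.I)) =
          Complex.exp (-((t : ℝ) * Complex.I)) * Complex.exp (-((t : ℝ) * Complex.I)) := by
        rw [← Complex.exp_add]
        congr 1
        push_cast
        ring
      have e' : Complex.exp (-((t : ℝ) * Complex.I)) * z = Complex.exp ((t : ℝ) * Complex.I) := by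
        rw [hz, ← Complex.exp_add]
        congr 1
        push_cast
        ring
      have e'' : (γ / 2 : ℂ) * Complex.exp (-((t : ℝ) * Complex.I)) +
          (2 - γ) / 2 * Complex.exp ((t : ℝ) * Complex.I) =
          (Real.cos t : ℂ) - (γ - 1) * Real.sin t * Complex.I := by
        rw [← neg_mul, Complex.exp_mul_I, Complex.exp_mul_I, Complex.cos_neg, Complex.sin_neg]
        push_cast
        ring
      rw [e, ← e'', ← e']
      ring
    have hB : Complex.exp (((γ - 1) * t - γ * Real.pi / 2 : ℝ) * Complex.I) =
        Complex.exp (-((t : ℝ) * Complex.I)) *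
          Complex.exp ((γ * (t - Real.pi / 2) : ℝ) * Complex.I) := by
      rw [← Complex.exp_add]
      congr 1
      push_cast
      ring
    rw [hB, ← mul_assoc, hA]
    ring
  have hpos : 0 < (2 * Real.sin t) ^ γ := Real.rpow_pos_of_pos (by linarith) _
  have key := wsgdSymbol_factor_sector hγ ht
  rw [hsymb, norm_mul, Complex.re_ofReal_mul, Complex.norm_real, Real.norm_of_nonneg hpos.le]
  nlinarith

lemma summable_wsgdSymbol {γ : ℝ} (hγ : γ ∈ Set.Ioo (1 : ℝ) 2) :
    Summable fun k => ‖(wcoef γ k : ℂ)‖ := by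
  simpa using (summable_wcoef hγ).abs

lemma norm_exp_sub_one_mul_I (k : ℕ) (θ : ℝ) :
    ‖Complex.exp (((k : ℂ) - 1) * θ * Complex.I)‖ = 1 := by
  have : ((k : ℂ) - 1) * θ = (((k : ℝ) - 1) * θ : ℝ) := by push_cast; ring
  rw [this, Complex.norm_exp_ofReal_mul_I]

lemma continuous_wsgdSymbol {γ : ℝ} (hγ : γ ∈ Set.Ioo (1 : ℝ) 2) : Continuous (wsgdSymbol γ) := by
  refine continuous_tsum (fun k => by fun_prop) (summable_wsgdSymbol hγ) fun k θ => ?_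
  rw [norm_mul, norm_exp_sub_one_mul_I, mul_one]

lemma integral_exp_int_mul_I (n : ℤ) :
    ∫ θ : ℝ in (0)..(2 * Real.pi), Complex.exp (n * Complex.I * θ) =
      if n = 0 then 2 * Real.pi else 0 := by
  split_ifs with h
  · simp [h]
  · have hc : (n : ℂ) * Complex.I ≠ 0 := mul_ne_zero (by exact_mod_cast h) Complex.I_ne_zero
    rw [integral_exp_mul_complex hc]
    have : (n : ℂ) * Complex.I * (2 * Real.pi : ℝ) = n * (2 * Real.pi * Complex.I) := by
      push_cast; ring
    rw [this, Complex.exp_int_mul_two_pi_mul_I]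
    simp

lemma integral_wsgdSymbol {γ : ℝ} (hγ : γ ∈ Set.Ioo (1 : ℝ) 2) (i j : ℕ) :
    ∫ θ : ℝ in (0)..(2 * Real.pi), wsgdSymbol γ θ *
        (Complex.exp (j * θ * Complex.I) * Complex.exp (-(i * θ * Complex.I))) =
      2 * Real.pi * ((if j ≤ i + 1 then wcoef γ (i + 1 - j) else 0 : ℝ) : ℂ) := by
  have hterm : ∀ (k : ℕ) (θ : ℝ), (wcoef γ k : ℂ) * Complex.exp (((k : ℂ) - 1) * θ * Complex.I) *
      (Complex.exp (j * θ * Complex.I) * Complex.exp (-(i * θ * Complex.I))) =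
      wcoef γ k * Complex.exp (((k - 1 + j - i : ℤ) : ℂ) * Complex.I * θ) := by
    intro k θ
    rw [mul_assoc, ← Complex.exp_add, ← Complex.exp_add]
    congr 2
    push_cast
    ring
  have hnorm : ∀ (n : ℤ) (θ : ℝ), ‖Complex.exp ((n : ℂ) * Complex.I * θ)‖ = 1 := by
    intro n θ
    have : (n : ℂ) * Complex.I * θ = ((n * θ : ℝ) : ℂ) * Complex.I := by push_cast; ring
    rw [this, Complex.norm_exp_ofReal_mul_I]
  have h := intervalIntegral.hasSum_integral_of_dominated_convergence (μ := MeasureTheory.volume)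
    (a := 0) (b := 2 * Real.pi)
    (F := fun (k : ℕ) (θ : ℝ) => (wcoef γ k : ℂ) *
      Complex.exp (((k - 1 + j - i : ℤ) : ℂ) * Complex.I * θ))
    (f := fun θ => wsgdSymbol γ θ *
        (Complex.exp (j * θ * Complex.I) * Complex.exp (-(i * θ * Complex.I))))
    (fun k _ => ‖(wcoef γ k : ℂ)‖)
    (fun k => Continuous.aestronglyMeasurable (by fun_prop))
    (fun k => Filter.Eventually.of_forall fun θ _ => by rw [norm_mul, hnorm, mul_one])
    (Filter.Eventually.of_forall fun θ _ => summable_wsgdSymbol hγ)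
    intervalIntegrable_const
    (Filter.Eventually.of_forall fun θ _ => by
      simp only [← hterm]
      refine HasSum.mul_right _ (Summable.hasSum (Summable.of_norm ?_))
      simpa only [norm_mul, norm_exp_sub_one_mul_I, mul_one] using summable_wsgdSymbol hγ)
  rw [← h.tsum_eq]
  simp only [intervalIntegral.integral_const_mul, integral_exp_int_mul_I]
  split_ifs with hij
  · rw [tsum_eq_single (i + 1 - j)]
    · rw [if_pos (by omega)]
      push_cast
      ring
    · intro k hk
      rw [if_neg (by omega), Complex.ofReal_zero, mul_zero]
  · have : ∀ k : ℕ, ¬ ((k : ℤ) - 1 + j - i = 0) := fun k => by omega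
    simp [this]

/-- The trigonometric polynomial with real coefficients `u`. -/
noncomputable def trigPoly {m : ℕ} (u : Fin m → ℝ) (θ : ℝ) : ℂ :=
  ∑ j, (u j : ℂ) * Complex.exp ((j : ℕ) * θ * Complex.I)

lemma continuous_trigPoly {m : ℕ} (u : Fin m → ℝ) : Continuous (trigPoly u) := by
  unfold trigPoly
  fun_prop

lemma conj_trigPoly {m : ℕ} (u : Fin m → ℝ) (θ : ℝ) :
    (starRingEnd ℂ) (trigPoly u θ) =
      ∑ j, (u j : ℂ) * Complex.exp (-((j : ℕ) * θ * Complex.I)) := by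
  simp [trigPoly, ← Complex.exp_conj]

lemma integral_wsgdSymbol_trigPoly {γ : ℝ} (hγ : γ ∈ Set.Ioo (1 : ℝ) 2) {m : ℕ}
    (u v : Fin m → ℝ) :
    ∫ θ : ℝ in (0)..(2 * Real.pi), wsgdSymbol γ θ *
        (trigPoly u θ * (starRingEnd ℂ) (trigPoly v θ)) =
      2 * Real.pi * ((v ⬝ᵥ Gmat γ m *ᵥ u : ℝ) : ℂ) := by
  have hcont := continuous_wsgdSymbol hγ
  have hexp : ∀ θ : ℝ, wsgdSymbol γ θ * (trigPoly u θ * (starRingEnd ℂ) (trigPoly v θ)) =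
      ∑ i, ∑ j, (v i * u j : ℂ) * (wsgdSymbol γ θ * (Complex.exp ((j : ℕ) * θ * Complex.I) *
        Complex.exp (-((i : ℕ) * θ * Complex.I)))) := by
    intro θ
    rw [conj_trigPoly, trigPoly, Finset.sum_mul_sum, Finset.sum_comm, Finset.mul_sum]
    refine Finset.sum_congr rfl fun i _ => ?_
    rw [Finset.mul_sum]
    refine Finset.sum_congr rfl fun j _ => ?_
    ring
  simp only [hexp]
  rw [intervalIntegral.integral_finsetSum
    fun i _ => Continuous.intervalIntegrable (by fun_prop) _ _]
  simp only [dotProduct, mulVec, Complex.ofReal_sum, Finset.mul_sum]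
  refine Finset.sum_congr rfl fun i _ => ?_
  rw [intervalIntegral.integral_finsetSum
    fun j _ => Continuous.intervalIntegrable (by fun_prop) _ _]
  refine Finset.sum_congr rfl fun j _ => ?_
  rw [intervalIntegral.integral_const_mul, integral_wsgdSymbol hγ]
  simp only [Gmat, of_apply]
  push_cast
  ring

lemma sector_re_nonneg {f a b : ℂ} {c : ℝ} (hc : 0 ≤ c) (h : c * ‖f‖ ≤ -f.re) :
    0 ≤ (-(f * (a * (starRingEnd ℂ) a)) - f * (b * (starRingEnd ℂ) b) -
      (2 * c : ℝ) * (f * (a * (starRingEnd ℂ) b))).re := by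
  have h1 : (f * (a * (starRingEnd ℂ) b)).re ≤ ‖f‖ * (‖a‖ * ‖b‖) := by
    refine (Complex.re_le_norm _).trans ?_
    simp
  have h2 : ∀ z : ℂ, (f * (z * (starRingEnd ℂ) z)).re = f.re * ‖z‖ ^ 2 := by
    intro z
    rw [Complex.mul_conj, Complex.re_mul_ofReal, Complex.normSq_eq_norm_sq]
  have h3 : c * (f * (a * (starRingEnd ℂ) b)).re ≤ c * (‖f‖ * (‖a‖ * ‖b‖)) :=
    mul_le_mul_of_nonneg_left h1 hc
  have h4 : c * ‖f‖ * (‖a‖ * ‖b‖) ≤ -f.re * (‖a‖ * ‖b‖) :=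
    mul_le_mul_of_nonneg_right h (by positivity)
  have h5 : 0 ≤ -f.re := le_trans (by positivity) h
  simp only [Complex.sub_re, Complex.neg_re, Complex.re_ofReal_mul, h2]
  nlinarith [mul_nonneg h5 (sq_nonneg (‖a‖ - ‖b‖))]

/-- Sectoriality of `Gmat γ m`, in polarized form. -/
lemma Gmat_sector {γ : ℝ} (hγ : γ ∈ Set.Ioo (1 : ℝ) 2) {m : ℕ} (u v : Fin m → ℝ) :
    2 * |Real.cos (γ * Real.pi / 2)| * (v ⬝ᵥ Gmat γ m *ᵥ u) ≤
      -(u ⬝ᵥ Gmat γ m *ᵥ u) - v ⬝ᵥ Gmat γ m *ᵥ v := by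
  set c := |Real.cos (γ * Real.pi / 2)| with hc
  have hf := continuous_wsgdSymbol hγ
  have hu := continuous_trigPoly u
  have hv := continuous_trigPoly v
  set F : ℝ → ℂ := fun θ =>
    -(wsgdSymbol γ θ * (trigPoly u θ * (starRingEnd ℂ) (trigPoly u θ))) -
      wsgdSymbol γ θ * (trigPoly v θ * (starRingEnd ℂ) (trigPoly v θ)) -
      (2 * c : ℝ) * (wsgdSymbol γ θ * (trigPoly u θ * (starRingEnd ℂ) (trigPoly v θ))) with hF
  have hFc : Continuous F := by fun_prop
  have hint : ∫ θ : ℝ in (0)..(2 * Real.pi), F θ = ((2 * Real.pi *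
      (-(u ⬝ᵥ Gmat γ m *ᵥ u) - v ⬝ᵥ Gmat γ m *ᵥ v - 2 * c * (v ⬝ᵥ Gmat γ m *ᵥ u)) : ℝ) : ℂ) := by
    rw [hF, intervalIntegral.integral_sub, intervalIntegral.integral_sub,
      intervalIntegral.integral_neg, intervalIntegral.integral_const_mul,
      integral_wsgdSymbol_trigPoly hγ, integral_wsgdSymbol_trigPoly hγ,
      integral_wsgdSymbol_trigPoly hγ]
    · push_cast
      ring
    all_goals exact Continuous.intervalIntegrable (by fun_prop) _ _
  have hre : ∫ θ : ℝ in (0)..(2 * Real.pi), (F θ).re = 2 * Real.pi *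
      (-(u ⬝ᵥ Gmat γ m *ᵥ u) - v ⬝ᵥ Gmat γ m *ᵥ v - 2 * c * (v ⬝ᵥ Gmat γ m *ᵥ u)) := by
    have := Complex.reCLM.intervalIntegral_comp_comm
      (hFc.intervalIntegrable (μ := MeasureTheory.volume) 0 (2 * Real.pi))
    rw [hint] at this
    simpa using this
  have hpi := Real.pi_pos
  have hnn : ∫ θ : ℝ in (0)..(2 * Real.pi), (0 : ℝ) ≤ ∫ θ : ℝ in (0)..(2 * Real.pi), (F θ).re :=
    intervalIntegral.integral_mono_on_of_le_Ioo (by linarith)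
      (Continuous.intervalIntegrable (by fun_prop) _ _)
      (Continuous.intervalIntegrable (by fun_prop) _ _)
      fun θ hθ => sector_re_nonneg (abs_nonneg _) (wsgdSymbol_sector hγ hθ)
  rw [hre, intervalIntegral.integral_zero] at hnn
  have := nonneg_of_mul_nonneg_right hnn (by linarith : 0 < 2 * Real.pi)
  linarith

/-- Off-diagonal entries, as a function of the distance to the diagonal, of the symmetric part
of `Gmat γ m`. -/
noncomputable def symCoef (γ : ℝ) : ℕ → ℝ
  | 0 => 0
  | 1 => (wcoef γ 0 + wcoef γ 2) / 2
  | (k+2) => wcoef γ (k+3) / 2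

lemma symCoef_nonneg {γ : ℝ} (hγ : γ ∈ Set.Ioo (1 : ℝ) 2) : ∀ r, 0 ≤ symCoef γ r
  | 0 => le_rfl
  | 1 => div_nonneg (wcoef_zero_add_two_nonneg hγ) zero_le_two
  | (k+2) => div_nonneg (wcoef_nonneg hγ k) zero_le_two

lemma two_mul_sum_symCoef_le {γ : ℝ} (hγ : γ ∈ Set.Ioo (1 : ℝ) 2) (n : ℕ) :
    2 * ∑ r ∈ Finset.range (n + 2), symCoef γ r ≤ -wcoef γ 1 := by
  have h := sum_wcoef_nonpos hγ n
  rw [Finset.sum_range_succ', Finset.sum_range_succ', Finset.sum_range_succ'] at h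
  rw [Finset.sum_range_succ', Finset.sum_range_succ']
  simp only [symCoef, ← Finset.sum_div]
  norm_num at h ⊢
  linarith

lemma Gmat_add_transpose (γ : ℝ) {m : ℕ} (i j : Fin m) :
    Gmat γ m i j + Gmat γ m j i =
      2 * ((if i = j then wcoef γ 1 else 0) + symCoef γ ((i - j : ℕ) + (j - i : ℕ))) := by
  wlog h : (j : ℕ) ≤ i generalizing i j
  · rw [add_comm, this j i (by omega), add_comm (j - i : ℕ)]
    simp only [eq_comm]
  obtain ⟨r, hr⟩ := Nat.exists_eq_add_of_le h
  have h1 : (i : ℕ) + 1 - j = r + 1 := by omega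
  have h2 : (i - j : ℕ) + (j - i : ℕ) = r := by omega
  simp only [Gmat, of_apply, h1, h2, Fin.ext_iff]
  rw [if_pos (by omega)]
  match r, hr with
  | 0, hr =>
    rw [if_pos (by omega), if_pos (by omega), show (j : ℕ) + 1 - i = 1 by omega]
    simp only [symCoef]
    ring
  | 1, hr =>
    rw [if_pos (by omega), if_neg (by omega), show (j : ℕ) + 1 - i = 0 by omega]
    simp only [symCoef]
    ring
  | (k+2), hr =>
    rw [if_neg (by omega), if_neg (by omega)]
    simp only [symCoef]
    ring

lemma neg_dotProduct_Gmat (γ : ℝ) {m : ℕ} (u : Fin m → ℝ) :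
    -(u ⬝ᵥ Gmat γ m *ᵥ u) = -wcoef γ 1 * ∑ i, u i ^ 2 -
      ∑ i : Fin m, ∑ j : Fin m, symCoef γ ((i - j : ℕ) + (j - i : ℕ)) * (u i * u j) := by
  have h1 : u ⬝ᵥ Gmat γ m *ᵥ u = ∑ i, ∑ j, Gmat γ m i j * (u i * u j) := by
    simp only [dotProduct, mulVec, Finset.mul_sum]
    exact Finset.sum_congr rfl fun i _ => Finset.sum_congr rfl fun j _ => by ring
  have h2 : u ⬝ᵥ Gmat γ m *ᵥ u = ∑ i, ∑ j, Gmat γ m j i * (u i * u j) := by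
    rw [h1, Finset.sum_comm]
    exact Finset.sum_congr rfl fun i _ => Finset.sum_congr rfl fun j _ => by ring
  have h3 : 2 * (u ⬝ᵥ Gmat γ m *ᵥ u) = ∑ i : Fin m, ∑ j : Fin m,
      (2 * ((if i = j then wcoef γ 1 else 0) + symCoef γ ((i - j : ℕ) + (j - i : ℕ)))) *
        (u i * u j) := by
    rw [two_mul]
    nth_rw 1 [h1]
    rw [h2]
    simp only [← Gmat_add_transpose, ← Finset.sum_add_distrib, add_mul]
  simp only [mul_assoc, add_mul, mul_add, ite_mul, zero_mul, Finset.sum_add_distrib, mul_ite,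
    mul_zero,
    ← Finset.mul_sum, Finset.sum_ite_eq, Finset.mem_univ, if_true] at h3
  simp only [pow_two]
  linarith

/-- Nonnegativity and midpoint convexity on a finite grid, with upper bound `c`. -/
structure IsGridConvex {m : ℕ} (e : Fin m → ℝ) (c : ℝ) : Prop where
  nonneg : ∀ i, 0 ≤ e i
  le : ∀ i, e i ≤ c
  midpoint : ∀ (i j k : Fin m), (i : ℕ) + k = 2 * j → 2 * e j ≤ e i + e k

lemma sum_dist_fiber_le {m : ℕ} {e : Fin m → ℝ} {c : ℝ} (he : IsGridConvex e c) (i : Fin m)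
    {r : ℕ} (hr : r ≠ 0) :
    ∑ j ∈ Finset.univ.filter (fun j : Fin m => (i - j : ℕ) + (j - i : ℕ) = r),
      (e i + c - e j) ≤ 2 * c := by
  have hi := he.nonneg i
  have hi' := he.le i
  have hset : ∀ j : Fin m, ((i - j : ℕ) + (j - i : ℕ)) = r ↔ (j : ℕ) = i + r ∨ (j : ℕ) + r = i := by
    intro j; omega
  simp only [hset]
  by_cases h1 : (i : ℕ) + r < m <;> by_cases h2 : r ≤ i
  · have : Finset.univ.filter (fun j : Fin m => (j : ℕ) = i + r ∨ (j : ℕ) + r = i) =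
        {⟨i + r, h1⟩, ⟨i - r, by omega⟩} := by
      ext j; simp [Fin.ext_iff]; omega
    rw [this, Finset.sum_pair (by simp [Fin.ext_iff]; omega)]
    have := he.midpoint ⟨i + r, h1⟩ i ⟨i - r, by omega⟩ (by simp; omega)
    linarith
  · have : Finset.univ.filter (fun j : Fin m => (j : ℕ) = i + r ∨ (j : ℕ) + r = i) =
        {⟨i + r, h1⟩} := by
      ext j; simp [Fin.ext_iff]; omega
    rw [this, Finset.sum_singleton]
    linarith [he.nonneg ⟨i + r, h1⟩]
  · have : Finset.univ.filter (fun j : Fin m => (j : ℕ) = i + r ∨ (j : ℕ) + r = i) =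
        {⟨i - r, by omega⟩} := by
      ext j; simp [Fin.ext_iff]; omega
    rw [this, Finset.sum_singleton]
    linarith [he.nonneg ⟨i - r, by omega⟩]
  · have : Finset.univ.filter (fun j : Fin m => (j : ℕ) = i + r ∨ (j : ℕ) + r = i) = ∅ := by
      ext j; simp; omega
    rw [this, Finset.sum_empty]
    linarith

lemma sum_symCoef_mul_le {γ : ℝ} (hγ : γ ∈ Set.Ioo (1 : ℝ) 2) {m : ℕ} {e : Fin m → ℝ} {c : ℝ}
    (he : IsGridConvex e c) (i : Fin m) :
    ∑ j : Fin m, symCoef γ ((i - j : ℕ) + (j - i : ℕ)) * (e i + c - e j) ≤ c * -wcoef γ 1 := by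
  have hc : 0 ≤ c := (he.nonneg i).trans (he.le i)
  have hmap : ∀ j ∈ (Finset.univ : Finset (Fin m)),
      ((i - j : ℕ) + (j - i : ℕ)) ∈ Finset.range (m + 2) := by
    intro j _; rw [Finset.mem_range]; omega
  rw [← Finset.sum_fiberwise_of_maps_to hmap]
  calc ∑ r ∈ Finset.range (m + 2), ∑ j ∈
        Finset.univ.filter (fun j : Fin m => (i - j : ℕ) + (j - i : ℕ) = r),
        symCoef γ ((i - j : ℕ) + (j - i : ℕ)) * (e i + c - e j)
      ≤ ∑ r ∈ Finset.range (m + 2), symCoef γ r * (2 * c) := by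
        refine Finset.sum_le_sum fun r _ => ?_
        rw [Finset.sum_congr rfl fun j hj => by rw [(Finset.mem_filter.1 hj).2],
          ← Finset.mul_sum]
        rcases eq_or_ne r 0 with rfl | hr
        · simp [symCoef]
        · exact mul_le_mul_of_nonneg_left (sum_dist_fiber_le he i hr) (symCoef_nonneg hγ r)
    _ ≤ c * -wcoef γ 1 := by
        rw [← Finset.sum_mul]
        nlinarith [two_mul_sum_symCoef_le hγ m]

lemma sum_symCoef_le {γ : ℝ} (hγ : γ ∈ Set.Ioo (1 : ℝ) 2) {m : ℕ} (i : Fin m) :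
    ∑ j : Fin m, symCoef γ ((i - j : ℕ) + (j - i : ℕ)) ≤ -wcoef γ 1 := by
  simpa using sum_symCoef_mul_le hγ (e := fun _ : Fin m => 0) (c := 1)
    ⟨fun _ => le_rfl, fun _ => zero_le_one, fun _ _ _ _ => by simp⟩ i

/-- Multiplication by a bounded grid-convex function is bounded for the quadratic form
of `-Gmat γ m`. -/
lemma neg_dotProduct_Gmat_mul_le {γ : ℝ} (hγ : γ ∈ Set.Ioo (1 : ℝ) 2) {m : ℕ} {e : Fin m → ℝ}
    {c : ℝ} (he : IsGridConvex e c) (u : Fin m → ℝ) :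
    -((e * u) ⬝ᵥ Gmat γ m *ᵥ (e * u)) ≤ 2 * c ^ 2 * -(u ⬝ᵥ Gmat γ m *ᵥ u) := by
  set s := -wcoef γ 1 with hs
  set T : Fin m → Fin m → ℝ := fun i j => symCoef γ ((i - j : ℕ) + (j - i : ℕ)) with hT
  have hT0 : ∀ i j, 0 ≤ T i j := fun i j => symCoef_nonneg hγ _
  have hTs : ∀ i j, T i j = T j i := fun i j => by simp only [hT, add_comm]
  have hK : ∀ i j, 0 ≤ 2 * c ^ 2 - e i * e j := fun i j => by
    nlinarith [mul_le_mul (he.le i) (he.le j) (he.nonneg j) ((he.nonneg i).trans (he.le i)),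
      sq_nonneg c]
  have hrow : ∀ i, ∑ j, T i j * (2 * c ^ 2 - e i * e j) ≤ s * (2 * c ^ 2 - e i ^ 2) := by
    intro i
    have h1 := mul_le_mul_of_nonneg_left (sum_symCoef_mul_le hγ he i) (he.nonneg i)
    have h2 := mul_le_mul_of_nonneg_right (sum_symCoef_le hγ i)
      (by nlinarith [he.nonneg i, he.le i] : 0 ≤ 2 * c ^ 2 - e i ^ 2 - c * e i)
    calc ∑ j, T i j * (2 * c ^ 2 - e i * e j)
        = e i * ∑ j, T i j * (e i + c - e j) + (∑ j, T i j) * (2 * c ^ 2 - e i ^ 2 - c * e i) := by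
          rw [Finset.mul_sum, Finset.sum_mul, ← Finset.sum_add_distrib]
          exact Finset.sum_congr rfl fun j _ => by ring
      _ ≤ _ := by linarith
  have hcross : ∑ i, ∑ j, T i j * (2 * c ^ 2 - e i * e j) * (u i * u j) ≤
      ∑ i, (∑ j, T i j * (2 * c ^ 2 - e i * e j)) * u i ^ 2 := by
    have h1 : ∑ i, ∑ j, T i j * (2 * c ^ 2 - e i * e j) * (u i * u j) ≤
        ∑ i, ∑ j, (T i j * (2 * c ^ 2 - e i * e j) * u i ^ 2 / 2 +
          T i j * (2 * c ^ 2 - e i * e j) * u j ^ 2 / 2) :=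
      Finset.sum_le_sum fun i _ => Finset.sum_le_sum fun j _ => by
        nlinarith [mul_nonneg (mul_nonneg (hT0 i j) (hK i j)) (sq_nonneg (u i - u j))]
    have h2 : ∑ i, ∑ j, T i j * (2 * c ^ 2 - e i * e j) * u j ^ 2 / 2 =
        ∑ i, ∑ j, T i j * (2 * c ^ 2 - e i * e j) * u i ^ 2 / 2 := by
      rw [Finset.sum_comm]
      exact Finset.sum_congr rfl fun i _ => Finset.sum_congr rfl fun j _ => by
        rw [hTs j i, mul_comm (e j)]
    simp only [Finset.sum_add_distrib, h2] at h1
    simp only [Finset.sum_mul]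
    simp only [← Finset.sum_div] at h1
    linarith
  have hdiag : ∑ i, (∑ j, T i j * (2 * c ^ 2 - e i * e j)) * u i ^ 2 ≤
      ∑ i, s * (2 * c ^ 2 - e i ^ 2) * u i ^ 2 :=
    Finset.sum_le_sum fun i _ => mul_le_mul_of_nonneg_right (hrow i) (sq_nonneg _)
  have e1 : ∑ i, s * (2 * c ^ 2 - e i ^ 2) * u i ^ 2 =
      2 * c ^ 2 * (s * ∑ i, u i ^ 2) - s * ∑ i, (e * u) i ^ 2 := by
    simp only [Finset.mul_sum, ← Finset.sum_sub_distrib, Pi.mul_apply]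
    exact Finset.sum_congr rfl fun i _ => by ring
  have e2 : ∑ i, ∑ j, T i j * (2 * c ^ 2 - e i * e j) * (u i * u j) =
      2 * c ^ 2 * ∑ i, ∑ j, T i j * (u i * u j) -
        ∑ i, ∑ j, T i j * ((e * u) i * (e * u) j) := by
    simp only [Finset.mul_sum, ← Finset.sum_sub_distrib, Pi.mul_apply]
    exact Finset.sum_congr rfl fun i _ => Finset.sum_congr rfl fun j _ => by ring
  rw [neg_dotProduct_Gmat, neg_dotProduct_Gmat]
  linarith

lemma Gmat_neg_semidef {γ : ℝ} (hγ : γ ∈ Set.Ioo (1 : ℝ) 2) {m : ℕ} (u : Fin m → ℝ) :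
    u ⬝ᵥ Gmat γ m *ᵥ u ≤ 0 := by
  have := Gmat_sector hγ u 0
  simp at this
  linarith

lemma abs_cos_mul_pi_div_two_pos {γ : ℝ} (hγ : γ ∈ Set.Ioo (1 : ℝ) 2) :
    0 < |Real.cos (γ * Real.pi / 2)| := by
  have := Real.pi_pos
  refine abs_pos.2 (Real.cos_neg_of_pi_div_two_lt_of_lt ?_ ?_).ne <;> nlinarith [hγ.1, hγ.2]

lemma abs_mul_dotProduct_Gmat_le {γ : ℝ} (hγ : γ ∈ Set.Ioo (1 : ℝ) 2) {m : ℕ} {e : Fin m → ℝ}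
    {c : ℝ} (hc : 0 ≤ c) (he : IsGridConvex e c) (u : Fin m → ℝ) :
    |(e * u) ⬝ᵥ Gmat γ m *ᵥ u| ≤
      Real.sqrt 2 * c / |Real.cos (γ * Real.pi / 2)| * -(u ⬝ᵥ Gmat γ m *ᵥ u) := by
  have hς := abs_cos_mul_pi_div_two_pos hγ
  rcases hc.eq_or_lt with rfl | hc
  · have : e = 0 := funext fun i => le_antisymm (he.le i) (he.nonneg i)
    simp [this]
  set t := Real.sqrt 2 * c with ht
  have htpos : 0 < t := by positivity
  have ht2 : t ^ 2 = 2 * c ^ 2 := by rw [ht, mul_pow, Real.sq_sqrt zero_le_two]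
  have hd := neg_dotProduct_Gmat_mul_le hγ he u
  rw [← ht2] at hd
  have h1 := Gmat_sector hγ (t • u) (e * u)
  have h2 := Gmat_sector hγ (t • u) (-(e * u))
  simp only [mulVec_smul, mulVec_neg, dotProduct_smul, smul_dotProduct, neg_dotProduct,
    dotProduct_neg, smul_eq_mul, neg_neg] at h1 h2
  rw [div_mul_eq_mul_div, le_div_iff₀ hς]
  refine le_of_mul_le_mul_left ?_ (by positivity : 0 < 2 * t)
  rcases abs_cases ((e * u) ⬝ᵥ Gmat γ m *ᵥ u) with ⟨h, _⟩ | ⟨h, _⟩ <;> rw [h] <;> linarith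

lemma mul_dotProduct_Gmat_nonpos {γ : ℝ} (hγ : γ ∈ Set.Ioo (1 : ℝ) 2) {m : ℕ} {d : Fin m → ℝ}
    {κmin κmax κ : ℝ} (hle : κmin ≤ κmax) (hbound : ∀ i, κmin ≤ d i ∧ d i ≤ κmax)
    (hκ : ((∀ (i j k : Fin m), (i : ℕ) + k = 2 * j → 2 * d j ≤ d i + d k) ∧ κ = κmin) ∨
      ((∀ (i j k : Fin m), (i : ℕ) + k = 2 * j → d i + d k ≤ 2 * d j) ∧ κ = κmax))
    (hcond : 0 ≤ κ - Real.sqrt 2 * (κmax - κmin) / |Real.cos (γ * Real.pi / 2)|)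
    (u : Fin m → ℝ) :
    (d * u) ⬝ᵥ Gmat γ m *ᵥ u ≤ 0 := by
  have hN := mul_nonneg hcond (neg_nonneg.2 (Gmat_neg_semidef hγ u))
  have key : ∀ (σ : ℝ) (e : Fin m → ℝ), |σ| = 1 → IsGridConvex e (κmax - κmin) →
      d = (fun _ => κ) + σ • e → (d * u) ⬝ᵥ Gmat γ m *ᵥ u ≤ 0 := by
    intro σ e hσ he hd
    have h := abs_mul_dotProduct_Gmat_le hγ (sub_nonneg.2 hle) he u
    have h1 : (d * u) ⬝ᵥ Gmat γ m *ᵥ u =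
        κ * (u ⬝ᵥ Gmat γ m *ᵥ u) + σ * ((e * u) ⬝ᵥ Gmat γ m *ᵥ u) := by
      rw [hd, add_mul, add_dotProduct, smul_mul_assoc, smul_dotProduct,
        show (fun _ => κ) * u = κ • u from rfl, smul_dotProduct, smul_eq_mul, smul_eq_mul]
    have h2 : σ * ((e * u) ⬝ᵥ Gmat γ m *ᵥ u) ≤ |(e * u) ⬝ᵥ Gmat γ m *ᵥ u| :=
      (le_abs_self _).trans_eq (by rw [abs_mul, hσ, one_mul])
    linarith
  rcases hκ with ⟨hconv, rfl⟩ | ⟨hconc, rfl⟩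
  · refine key 1 (fun i => d i - κ) (by simp) ⟨fun i => ?_, fun i => ?_, fun i j k h => ?_⟩ ?_
    · linarith [hbound i]
    · linarith [hbound i]
    · linarith [hconv i j k h]
    · ext i; simp
  · refine key (-1) (fun i => κ - d i) (by simp) ⟨fun i => ?_, fun i => ?_, fun i j k h => ?_⟩ ?_
    · linarith [hbound i]
    · linarith [hbound i]
    · linarith [hconc i j k h]
    · ext i; simp

lemma grid_mem_Ioo {a b h : ℝ} (hab : a < b) {m : ℕ} (hh : h = (b - a) / (m + 1)) (i : Fin m) :
    a + ((i : ℕ) + 1) * h ∈ Set.Ioo a b := by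
  have hm : (0 : ℝ) < m + 1 := by positivity
  have hpos : 0 < h := hh ▸ div_pos (sub_pos.2 hab) hm
  have hb : (m + 1) * h = b - a := by rw [hh]; field_simp
  have hi : ((i : ℕ) : ℝ) + 1 ≤ m := by exact_mod_cast i.2
  constructor <;> nlinarith [(Nat.cast_nonneg (i : ℕ) : (0 : ℝ) ≤ (i : ℕ))]

lemma ConvexOn.two_mul_grid_le {a b h : ℝ} {f : ℝ → ℝ} (hf : ConvexOn ℝ (Set.Ioo a b) f)
    (hab : a < b) {m : ℕ} (hh : h = (b - a) / (m + 1)) (i j k : Fin m)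
    (hijk : (i : ℕ) + k = 2 * j) :
    2 * f (a + ((j : ℕ) + 1) * h) ≤ f (a + ((i : ℕ) + 1) * h) + f (a + ((k : ℕ) + 1) * h) := by
  have hmid := hf.2 (grid_mem_Ioo hab hh i) (grid_mem_Ioo hab hh k)
    (by norm_num : (0 : ℝ) ≤ 1 / 2) (by norm_num : (0 : ℝ) ≤ 1 / 2) (by norm_num)
  have hcast : ((i : ℕ) : ℝ) + (k : ℕ) = 2 * (j : ℕ) := by exact_mod_cast hijk
  have harg : (1 / 2 : ℝ) • (a + ((i : ℕ) + 1) * h) + (1 / 2 : ℝ) • (a + ((k : ℕ) + 1) * h) =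
      a + ((j : ℕ) + 1) * h := by
    simp only [smul_eq_mul]
    linear_combination (h / 2) * hcast
  rw [harg] at hmid
  simp only [smul_eq_mul] at hmid
  linarith

lemma grid_mul_dotProduct_Gmat_nonpos {γ : ℝ} (hγ : γ ∈ Set.Ioo (1 : ℝ) 2) {m : ℕ}
    {a b h : ℝ} (hab : a < b) (hh : h = (b - a) / (m + 1)) {f : ℝ → ℝ} {κmin κmax κ : ℝ}
    (hbound : ∀ x ∈ Set.Ioo a b, κmin ≤ f x ∧ f x ≤ κmax)
    (hκ : (ConvexOn ℝ (Set.Ioo a b) f ∧ κ = κmin) ∨ (ConcaveOn ℝ (Set.Ioo a b) f ∧ κ = κmax))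
    (hcond : 0 ≤ κ - Real.sqrt 2 * (κmax - κmin) / |Real.cos (γ * Real.pi / 2)|)
    (u : Fin m → ℝ) :
    ((fun i : Fin m => f (a + ((i : ℕ) + 1) * h)) * u) ⬝ᵥ Gmat γ m *ᵥ u ≤ 0 := by
  obtain ⟨x, hx⟩ := Set.nonempty_Ioo.2 hab
  refine mul_dotProduct_Gmat_nonpos hγ ((hbound x hx).1.trans (hbound x hx).2)
    (fun i => hbound _ (grid_mem_Ioo hab hh i)) ?_ hcond u
  refine hκ.imp (And.imp_left fun hf => hf.two_mul_grid_le hab hh)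
    (And.imp_left fun hf i j k hijk => ?_)
  have := hf.neg.two_mul_grid_le hab hh i j k hijk
  simp only [Pi.neg_apply] at this
  linarith

lemma dotProduct_diagonal_mul_one_kronecker {m n : ℕ} (f : Fin n × Fin m → ℝ)
    (G : Matrix (Fin m) (Fin m) ℝ) (X : Fin n × Fin m → ℝ) :
    X ⬝ᵥ (Matrix.diagonal f * ((1 : Matrix (Fin n) (Fin n) ℝ) ⊗ₖ G)) *ᵥ X =
      ∑ j, ((fun i => f (j, i)) * fun i => X (j, i)) ⬝ᵥ G *ᵥ fun i => X (j, i) := by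
  simp only [dotProduct, mulVec, diagonal_mul, kroneckerMap_apply, one_apply, Pi.mul_apply,
    Fintype.sum_prod_type]
  refine Finset.sum_congr rfl fun j _ => Finset.sum_congr rfl fun i _ => ?_
  rw [Finset.sum_eq_single j (fun k _ hk => by simp [hk.symm]) (by simp)]
  simp only [if_true, one_mul, mul_assoc, ← Finset.mul_sum]
  ring

lemma dotProduct_diagonal_mul_kronecker_one {m n : ℕ} (f : Fin n × Fin m → ℝ)
    (G : Matrix (Fin n) (Fin n) ℝ) (X : Fin n × Fin m → ℝ) :
    X ⬝ᵥ (Matrix.diagonal f * (G ⊗ₖ (1 : Matrix (Fin m) (Fin m) ℝ))) *ᵥ X =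
      ∑ i, ((fun j => f (j, i)) * fun j => X (j, i)) ⬝ᵥ G *ᵥ fun j => X (j, i) := by
  simp only [dotProduct, mulVec, diagonal_mul, kroneckerMap_apply, one_apply, Pi.mul_apply,
    Fintype.sum_prod_type_right]
  refine Finset.sum_congr rfl fun i _ => Finset.sum_congr rfl fun j _ => ?_
  rw [Finset.sum_eq_single i (fun k _ hk => by simp [hk.symm]) (by simp)]
  simp only [if_true, mul_one, mul_assoc, ← Finset.mul_sum]
  ring

lemma posSemidef_neg_symmetric_part {ι : Type*} [Fintype ι] {A : Matrix ι ι ℝ}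
    (hA : ∀ X : ι → ℝ, X ⬝ᵥ A *ᵥ X ≤ 0) : (-(((1 : ℝ) / 2) • (A + Aᵀ))).PosSemidef := by
  refine PosSemidef.of_dotProduct_mulVec_nonneg ?_ fun X => ?_
  · ext i j
    simp [add_comm]
  · have hT : X ⬝ᵥ Aᵀ *ᵥ X = X ⬝ᵥ A *ᵥ X := by
      rw [mulVec_transpose, dotProduct_comm, dotProduct_mulVec]
    simp only [star_trivial, neg_mulVec, smul_mulVec, add_mulVec, dotProduct_neg,
      dotProduct_smul, dotProduct_add, hT, smul_eq_mul]
    linarith [hA X]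

/-- Corollary 3.2(i): under slice-wise bounds and convexity/concavity of the variable
coefficients, together with the conditions
`κ^d(y) − √2(κ^d_max(y) − κ^d_min(y))/ς_α ≥ 0` and
`κ^e(x) − √2(κ^e_max(x) − κ^e_min(x))/ς_β ≥ 0`, the symmetric part `(A + Aᵀ)/2` of the
2D discretization matrix `A` is negative semidefinite. -/
theorem symmetric_part_A_negSemidef (α β : ℝ)
    (hα : α ∈ Set.Ioo (1 : ℝ) 2) (hβ : β ∈ Set.Ioo (1 : ℝ) 2)
    (M₁ M₂ : ℕ) (hM₁ : 0 < M₁) (hM₂ : 0 < M₂)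
    (xL xR yL yR : ℝ) (hx : xL < xR) (hy : yL < yR)
    (h₁ h₂ : ℝ) (hh₁ : h₁ = (xR - xL) / (M₁ + 1)) (hh₂ : h₂ = (yR - yL) / (M₂ + 1))
    (d e : ℝ → ℝ → ℝ)
    (κdmin κdmax κd : ℝ → ℝ) (κemin κemax κe : ℝ → ℝ)
    (hκdmin : ∀ y ∈ Set.Ioo yL yR, 0 ≤ κdmin y)
    (hκemin : ∀ x ∈ Set.Ioo xL xR, 0 ≤ κemin x)
    (hdbound : ∀ x ∈ Set.Ioo xL xR, ∀ y ∈ Set.Ioo yL yR,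
      κdmin y ≤ d x y ∧ d x y ≤ κdmax y)
    (hebound : ∀ x ∈ Set.Ioo xL xR, ∀ y ∈ Set.Ioo yL yR,
      κemin x ≤ e x y ∧ e x y ≤ κemax x)
    (hκd : ∀ y ∈ Set.Ioo yL yR,
      (ConvexOn ℝ (Set.Ioo xL xR) (fun x => d x y) ∧ κd y = κdmin y) ∨
      (ConcaveOn ℝ (Set.Ioo xL xR) (fun x => d x y) ∧ κd y = κdmax y))
    (hκe : ∀ x ∈ Set.Ioo xL xR,
      (ConvexOn ℝ (Set.Ioo yL yR) (fun y => e x y) ∧ κe x = κemin x) ∨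
      (ConcaveOn ℝ (Set.Ioo yL yR) (fun y => e x y) ∧ κe x = κemax x))
    (hconds1 : ∀ y ∈ Set.Ioo yL yR,
      0 ≤ κd y - Real.sqrt 2 * (κdmax y - κdmin y) / |Real.cos (α * Real.pi / 2)|)
    (hconds2 : ∀ x ∈ Set.Ioo xL xR,
      0 ≤ κe x - Real.sqrt 2 * (κemax x - κemin x) / |Real.cos (β * Real.pi / 2)|)
    (D E A : Matrix (Fin M₂ × Fin M₁) (Fin M₂ × Fin M₁) ℝ)
    (hD : D = Matrix.diagonal fun p => d (xL + ((p.2 : ℕ) + 1) * h₁) (yL + ((p.1 : ℕ) + 1) * h₂))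
    (hE : E = Matrix.diagonal fun p => e (xL + ((p.2 : ℕ) + 1) * h₁) (yL + ((p.1 : ℕ) + 1) * h₂))
    (hA : A = (1 / (2 * h₁ ^ α)) • (D * ((1 : Matrix (Fin M₂) (Fin M₂) ℝ) ⊗ₖ Gmat α M₁)) +
              (1 / (2 * h₂ ^ β)) • (E * (Gmat β M₂ ⊗ₖ (1 : Matrix (Fin M₁) (Fin M₁) ℝ)))) :
    (-(((1 : ℝ) / 2) • (A + Aᵀ))).PosSemidef := by
  have hh₁' : 0 < h₁ := hh₁ ▸ div_pos (sub_pos.2 hx) (by positivity)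
  have hh₂' : 0 < h₂ := hh₂ ▸ div_pos (sub_pos.2 hy) (by positivity)
  refine posSemidef_neg_symmetric_part fun X => ?_
  rw [hA, hD, hE, add_mulVec, smul_mulVec, smul_mulVec, dotProduct_add, dotProduct_smul,
    dotProduct_smul, dotProduct_diagonal_mul_one_kronecker, dotProduct_diagonal_mul_kronecker_one]
  refine add_nonpos
    (mul_nonpos_of_nonneg_of_nonpos (by positivity) (Finset.sum_nonpos fun j _ => ?_))
    (mul_nonpos_of_nonneg_of_nonpos (by positivity) (Finset.sum_nonpos fun i _ => ?_))
  · have hj := grid_mem_Ioo hy hh₂ j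
    exact grid_mul_dotProduct_Gmat_nonpos hα hx hh₁ (fun x hx' => hdbound x hx' _ hj)
      (hκd _ hj) (hconds1 _ hj) _
  · have hi := grid_mem_Ioo hx hh₁ i
    exact grid_mul_dotProduct_Gmat_nonpos hβ hy hh₂ (hebound _ hi)
      (hκe _ hi) (hconds2 _ hi) _
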